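/- For any N-qubit pure state |ψ⟩ on qubits A, B, C₁, …, C_{N−2} (N ≥ 3), set a = C²(|ψ⟩_{A|BC₁…C_{N−2}}), b = C²(|ψ⟩_{B|AC₁…C_{N−2}}), and c = C²(|ψ⟩_{AB|C₁…C_{N−2}}). Then the three nonnegative numbers a, b, c satisfy the triangle inequalities: a ≤ b + c, b ≤ a + c, and c ≤ a + b (equivalently, there exist plane vectors with lengths a, b, c forming a triangle). -/

import Mathlib

open scoped BigOperators

noncomputable section

/-- Partial trace over the second tensor factor:
`(ptraceRight ρ) s s' = ∑ t, ρ (s,t) (s',t)`. -/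
def ptraceRight {S T : Type*} [Fintype S] [Fintype T]
    (ρ : Matrix (S × T) (S × T) ℂ) : Matrix S S ℂ :=
  fun s s' => ∑ t : T, ρ (s, t) (s', t)

/-- Partial trace over the first tensor factor. -/
def ptraceLeft {S T : Type*} [Fintype S] [Fintype T]
    (ρ : Matrix (S × T) (S × T) ℂ) : Matrix T T ℂ :=
  fun t t' => ∑ s : S, ρ (s, t) (s, t')

/-- The density matrix `|ψ⟩⟨ψ|` of a (pure) state vector `ψ`. -/
def pureDM {d : Type*} (ψ : d → ℂ) : Matrix d d ℂ :=
  fun x y => ψ x * (starRingEnd ℂ) (ψ y)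

/-- `Tr(ρ²)` (real part) of a square matrix. -/
def trSq {S : Type*} [Fintype S] (ρ : Matrix S S ℂ) : ℝ :=
  ((ρ * ρ).trace).re

/-- Linear entropy `T(ρ) = 1 - Tr(ρ²)`. -/
def linEnt {S : Type*} [Fintype S] (ρ : Matrix S S ℂ) : ℝ :=
  1 - trSq ρ

/-- Concurrence of a bipartite pure state `ψ : S × T → ℂ` (with respect to the
bipartition `S | T`): `C(ψ) = √(2 (1 - Tr ρ_S²))`. -/
def pureConc {S T : Type*} [Fintype S] [Fintype T] (ψ : S × T → ℂ) : ℝ :=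
  Real.sqrt (2 * (1 - trSq (ptraceRight (pureDM ψ))))

/-- The set of average pure-state concurrences over all finite pure-state
ensembles realizing the bipartite density matrix `ρ`. -/
def concSet {S T : Type*} [Fintype S] [Fintype T]
    (ρ : Matrix (S × T) (S × T) ℂ) : Set ℝ :=
  { c | ∃ (n : ℕ) (p : Fin n → ℝ) (φ : Fin n → S × T → ℂ),
      (∀ i, 0 ≤ p i) ∧ (∑ i, p i = 1) ∧
      (∀ i, ∑ x, ‖φ i x‖ ^ 2 = 1) ∧
      (ρ = ∑ i, (p i : ℂ) • pureDM (φ i)) ∧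
      c = ∑ i, p i * pureConc (φ i) }

/-- Concurrence of a bipartite mixed state (convex-roof extension). -/
def conc {S T : Type*} [Fintype S] [Fintype T]
    (ρ : Matrix (S × T) (S × T) ℂ) : ℝ :=
  sInf (concSet ρ)

/-- Concurrence of assistance of a bipartite mixed state. -/
def concA {S T : Type*} [Fintype S] [Fintype T]
    (ρ : Matrix (S × T) (S × T) ℂ) : ℝ :=
  sSup (concSet ρ)

/-- Concurrence of an `N`-qubit pure state `ψ` across the cut given by the
predicate `P` (the qubits satisfying `P` versus the rest). -/
def qubitCut {N : ℕ} (P : Fin N → Prop) [DecidablePred P]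
    (ψ : (Fin N → Fin 2) → ℂ) : ℝ :=
  pureConc (fun x : ({i // P i} → Fin 2) × ({i // ¬ P i} → Fin 2) =>
    ψ ((Equiv.piEquivPiSubtypeProd P (fun _ => Fin 2)).symm x))

/-- Assemble a full `N`-qubit configuration from values `x` at qubit `u`,
`y` at qubit `v`, and `f` elsewhere. -/
def assemble2 {N : ℕ} (u v : Fin N) (x y : Fin 2)
    (f : {i : Fin N // i ≠ u ∧ i ≠ v} → Fin 2) : Fin N → Fin 2 :=
  fun i => if h : i = u then x else if h' : i = v then y else f ⟨i, h, h'⟩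

/-- The two-qubit reduced density matrix of the `N`-qubit pure state `ψ` on the
(ordered) pair of qubits `u, v`, obtained by tracing out all other qubits. -/
def rdm2 {N : ℕ} (u v : Fin N) (ψ : (Fin N → Fin 2) → ℂ) :
    Matrix (Fin 2 × Fin 2) (Fin 2 × Fin 2) ℂ :=
  fun x y => ∑ f : {i : Fin N // i ≠ u ∧ i ≠ v} → Fin 2,
    ψ (assemble2 u v x.1 x.2 f) * (starRingEnd ℂ) (ψ (assemble2 u v y.1 y.2 f))

/-- The reduced density matrix of the `N`-qubit pure state `ψ` obtained by
tracing out the single qubit `v`, organized as a bipartite state on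
qubit `u` versus all remaining qubits. -/
def rdm1Rest {N : ℕ} (u v : Fin N) (ψ : (Fin N → Fin 2) → ℂ) :
    Matrix (Fin 2 × ({i : Fin N // i ≠ u ∧ i ≠ v} → Fin 2))
           (Fin 2 × ({i : Fin N // i ≠ u ∧ i ≠ v} → Fin 2)) ℂ :=
  fun x y => ∑ t : Fin 2,
    ψ (assemble2 u v x.1 t x.2) * (starRingEnd ℂ) (ψ (assemble2 u v y.1 t y.2))

open scoped ComplexConjugate

/-- If `σ` and `τ` are commuting involutions permuting the coordinates of `w`, then
`⟨w, (1 - σ)(1 - τ) w⟩` is nonnegative. -/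
lemma re_sum_mul_conj_antisymm_nonneg {X : Type*} [Fintype X] (w : X → ℂ) (σ τ : X → X)
    (hσ : Function.Involutive σ) (hτ : Function.Involutive τ) (hστ : ∀ x, σ (τ x) = τ (σ x)) :
    0 ≤ (∑ x, w x * conj (w x - w (σ x) - w (τ x) + w (σ (τ x)))).re := by
  set v : X → ℂ := fun x => w x - w (σ x) - w (τ x) + w (σ (τ x)) with hv
  have vσ : ∀ x, v (σ x) = -v x := fun x => by
    simp only [hv, ← hστ, hσ _]; ring
  have vτ : ∀ x, v (τ x) = -v x := fun x => by
    simp only [hv, hτ _]; rw [hστ x]; ring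
  have move : ∀ ρ : X → X, Function.Involutive ρ → (∀ x, v (ρ x) = -v x) → ∀ u : X → ℂ,
      ∑ x, u (ρ x) * conj (v x) = -∑ x, u x * conj (v x) := by
    intro ρ hρ hvρ u
    rw [← Equiv.sum_comp hρ.toPerm, ← Finset.sum_neg_distrib]
    refine Finset.sum_congr rfl fun x _ => ?_
    simp [hρ x, hvρ]
  have hsq : ∑ x, v x * conj (v x) = 4 * ∑ x, w x * conj (v x) := by
    have h1 := move σ hσ vσ w
    have h2 := move τ hτ vτ w
    have h3 := move τ hτ vτ (fun x => w (σ x))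
    have expand : ∑ x, v x * conj (v x) = ∑ x, w x * conj (v x) - ∑ x, w (σ x) * conj (v x)
        - ∑ x, w (τ x) * conj (v x) + ∑ x, w (σ (τ x)) * conj (v x) := by
      rw [← Finset.sum_sub_distrib, ← Finset.sum_sub_distrib, ← Finset.sum_add_distrib]
      refine Finset.sum_congr rfl fun x _ => ?_
      rw [show v x = w x - w (σ x) - w (τ x) + w (σ (τ x)) from rfl]; ring
    rw [expand, h3, h2, h1]; ring
  have hnn : 0 ≤ (∑ x, v x * conj (v x)).re := by
    rw [Complex.re_sum]
    refine Finset.sum_nonneg fun x _ => ?_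
    rw [Complex.mul_conj, Complex.ofReal_re]
    exact Complex.normSq_nonneg _
  rw [hsq] at hnn
  have : (4 * ∑ x, w x * conj (v x)).re = 4 * (∑ x, w x * conj (v x)).re := by simp
  linarith

/-- Exchange the coordinates satisfying `P` between two configurations. -/
def swapOn {ι α : Type*} (P : ι → Prop) [DecidablePred P] (x : (ι → α) × (ι → α)) :
    (ι → α) × (ι → α) :=
  (fun i => if P i then x.2 i else x.1 i, fun i => if P i then x.1 i else x.2 i)

lemma swapOn_involutive {ι α : Type*} (P : ι → Prop) [DecidablePred P] :
    Function.Involutive (swapOn (α := α) P) := by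
  intro x
  ext i <;> by_cases h : P i <;> simp [swapOn, h]

lemma swapOn_swapOn_comm {ι α : Type*} (P Q : ι → Prop) [DecidablePred P] [DecidablePred Q]
    (x : (ι → α) × (ι → α)) : swapOn P (swapOn Q x) = swapOn Q (swapOn P x) := by
  ext i <;> by_cases h : P i <;> by_cases h' : Q i <;> simp [swapOn, h, h']

lemma swapOn_swapOn_of_disjoint {ι α : Type*} (P Q R : ι → Prop) [DecidablePred P]
    [DecidablePred Q] [DecidablePred R] (hPQ : ∀ i, P i → ¬ Q i) (hR : ∀ i, R i ↔ P i ∨ Q i)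
    (x : (ι → α) × (ι → α)) : swapOn P (swapOn Q x) = swapOn R x := by
  ext i <;> have := hPQ i <;> by_cases h : P i <;> by_cases h' : Q i <;>
    simp_all [swapOn]

/-- The purity of the reduction of `ψ` to the coordinates satisfying `P`, as the expectation of
the partial swap on two copies of `ψ`. -/
def swapPurity {ι α : Type*} [Fintype ι] [DecidableEq ι] [Fintype α] (P : ι → Prop)
    [DecidablePred P] (ψ : (ι → α) → ℂ) : ℝ :=
  (∑ x : (ι → α) × (ι → α),
    ψ x.1 * ψ x.2 * conj (ψ (swapOn P x).1 * ψ (swapOn P x).2)).re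

section swapPurity

variable {ι α : Type*} [Fintype ι] [DecidableEq ι] [Fintype α]

lemma swapPurity_compl (P Q : ι → Prop) [DecidablePred P] [DecidablePred Q]
    (h : ∀ i, Q i ↔ ¬ P i) (ψ : (ι → α) → ℂ) : swapPurity Q ψ = swapPurity P ψ := by
  unfold swapPurity
  congr 1
  refine Finset.sum_congr rfl fun x _ => ?_
  have h1 : (swapOn Q x).1 = (swapOn P x).2 := by
    ext i; by_cases hi : P i <;> simp [swapOn, h, hi]
  have h2 : (swapOn Q x).2 = (swapOn P x).1 := by
    ext i; by_cases hi : P i <;> simp [swapOn, h, hi]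
  rw [h1, h2, mul_comm (ψ (swapOn P x).2)]

lemma sum_mul_conj_pair (ψ : (ι → α) → ℂ) (hψ : ∑ x, ‖ψ x‖ ^ 2 = 1) :
    ∑ x : (ι → α) × (ι → α), ψ x.1 * ψ x.2 * conj (ψ x.1 * ψ x.2) = 1 := by
  have h : ∑ x, ψ x * conj (ψ x) = 1 := by
    simp_rw [Complex.mul_conj']
    exact_mod_cast hψ
  rw [Fintype.sum_prod_type, ← mul_one (1 : ℂ)]
  nth_rewrite 1 [← h]
  rw [← h, Finset.sum_mul_sum]
  refine Finset.sum_congr rfl fun x _ => Finset.sum_congr rfl fun y _ => ?_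
  rw [map_mul]; ring

lemma swapPurity_true (ψ : (ι → α) → ℂ) (hψ : ∑ x, ‖ψ x‖ ^ 2 = 1) :
    swapPurity (fun _ : ι => True) ψ = 1 := by
  rw [swapPurity_compl (fun _ => False) (fun _ => True) (by simp)]
  simp only [swapPurity, swapOn, if_false]
  rw [sum_mul_conj_pair ψ hψ, Complex.one_re]

/-- Subadditivity of the linear entropy. -/
lemma swapPurity_add_le (P Q R : ι → Prop) [DecidablePred P] [DecidablePred Q]
    [DecidablePred R] (hPQ : ∀ i, P i → ¬ Q i) (hR : ∀ i, R i ↔ P i ∨ Q i)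
    (ψ : (ι → α) → ℂ) (hψ : ∑ x, ‖ψ x‖ ^ 2 = 1) :
    swapPurity P ψ + swapPurity Q ψ ≤ 1 + swapPurity R ψ := by
  have h := re_sum_mul_conj_antisymm_nonneg
    (fun x : (ι → α) × (ι → α) => ψ x.1 * ψ x.2) (swapOn P) (swapOn Q)
    (swapOn_involutive P) (swapOn_involutive Q) (swapOn_swapOn_comm P Q)
  simp only [swapOn_swapOn_of_disjoint P Q R hPQ hR, map_add, map_sub, mul_add, mul_sub,
    Finset.sum_add_distrib, Finset.sum_sub_distrib, Complex.add_re, Complex.sub_re] at h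
  rw [sum_mul_conj_pair ψ hψ, Complex.one_re] at h
  unfold swapPurity
  linarith

lemma swapPurity_le_one (P : ι → Prop) [DecidablePred P] (ψ : (ι → α) → ℂ)
    (hψ : ∑ x, ‖ψ x‖ ^ 2 = 1) : swapPurity P ψ ≤ 1 := by
  have h := swapPurity_add_le P (fun i => ¬ P i) (fun _ => True) (by simp)
    (fun i => by simp [Classical.em]) ψ hψ
  rw [swapPurity_true ψ hψ, swapPurity_compl P (fun i => ¬ P i) (fun _ => Iff.rfl)] at h
  linarith

lemma swapPurity_eq_trSq (P : ι → Prop) [DecidablePred P] (ψ : (ι → α) → ℂ) :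
    swapPurity P ψ = trSq (ptraceRight (pureDM
      (fun x : ({i // P i} → α) × ({i // ¬ P i} → α) =>
        ψ ((Equiv.piEquivPiSubtypeProd P (fun _ => α)).symm x)))) := by
  set e := (Equiv.piEquivPiSubtypeProd P (fun _ => α)).symm with he
  have hswap : ∀ s t s' t', swapOn P (e (s, t), e (s', t')) = (e (s', t), e (s, t')) := by
    intro s t s' t'
    ext i <;> by_cases hi : P i <;> simp [swapOn, he, hi]
  unfold swapPurity trSq
  congr 1
  rw [← Equiv.sum_comp (e.prodCongr e)]
  simp only [Fintype.sum_prod_type, Equiv.prodCongr_apply, Prod.map_apply, hswap,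
    Matrix.trace, Matrix.diag, Matrix.mul_apply, ptraceRight, pureDM]
  refine Finset.sum_congr rfl fun s _ => ?_
  rw [Finset.sum_comm]
  refine Finset.sum_congr rfl fun s' _ => ?_
  rw [Finset.sum_mul_sum]
  refine Finset.sum_congr rfl fun t _ => Finset.sum_congr rfl fun t' _ => ?_
  rw [map_mul]; ring

end swapPurity

lemma qubitCut_sq {N : ℕ} (P : Fin N → Prop) [DecidablePred P] (ψ : (Fin N → Fin 2) → ℂ)
    (hψ : ∑ x, ‖ψ x‖ ^ 2 = 1) : qubitCut P ψ ^ 2 = 2 * (1 - swapPurity P ψ) := by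
  have h := swapPurity_le_one P ψ hψ
  rw [swapPurity_eq_trSq] at h ⊢
  exact Real.sq_sqrt (by linarith)

/-- The three squared concurrences `a = C²(ψ_{A|B C₁…})`, `b = C²(ψ_{B|A C₁…})`
and `c = C²(ψ_{AB|C₁…})` satisfy the triangle inequalities.
Qubits: `A = 0`, `B = 1`. -/
theorem squared_concurrences_triangle
    (N : ℕ) (hN : 3 ≤ N) (ψ : (Fin N → Fin 2) → ℂ)
    (hψ : ∑ x, ‖ψ x‖ ^ 2 = 1)
    (a b c : ℝ)
    (ha : a = (qubitCut (fun i : Fin N => i = (⟨0, by omega⟩ : Fin N)) ψ) ^ 2)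
    (hb : b = (qubitCut (fun i : Fin N => i = (⟨1, by omega⟩ : Fin N)) ψ) ^ 2)
    (hc : c = (qubitCut (fun i : Fin N => (i : ℕ) < 2) ψ) ^ 2) :
    0 ≤ a ∧ 0 ≤ b ∧ 0 ≤ c ∧ a ≤ b + c ∧ b ≤ a + c ∧ c ≤ a + b := by
  refine ⟨ha ▸ sq_nonneg _, hb ▸ sq_nonneg _, hc ▸ sq_nonneg _, ?_⟩
  rw [qubitCut_sq _ ψ hψ] at ha hb hc
  have hAB := swapPurity_add_le (fun i : Fin N => i = (⟨0, by omega⟩ : Fin N))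
    (fun i : Fin N => i = (⟨1, by omega⟩ : Fin N)) (fun i : Fin N => (i : ℕ) < 2)
    (fun i => by simp only [Fin.ext_iff]; omega) (fun i => by simp only [Fin.ext_iff]; omega) ψ hψ
  have hAC := swapPurity_add_le (fun i : Fin N => i = (⟨0, by omega⟩ : Fin N))
    (fun i : Fin N => ¬ (i : ℕ) < 2) (fun i : Fin N => ¬ i = (⟨1, by omega⟩ : Fin N))
    (fun i => by simp only [Fin.ext_iff]; omega) (fun i => by simp only [Fin.ext_iff]; omega) ψ hψ
  have hBC := swapPurity_add_le (fun i : Fin N => i = (⟨1, by omega⟩ : Fin N))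
    (fun i : Fin N => ¬ (i : ℕ) < 2) (fun i : Fin N => ¬ i = (⟨0, by omega⟩ : Fin N))
    (fun i => by simp only [Fin.ext_iff]; omega) (fun i => by simp only [Fin.ext_iff]; omega) ψ hψ
  rw [swapPurity_compl (fun i : Fin N => (i : ℕ) < 2) _ (fun _ => Iff.rfl),
    swapPurity_compl (fun i : Fin N => i = (⟨1, by omega⟩ : Fin N)) _ (fun _ => Iff.rfl)] at hAC
  rw [swapPurity_compl (fun i : Fin N => (i : ℕ) < 2) _ (fun _ => Iff.rfl),
    swapPurity_compl (fun i : Fin N => i = (⟨0, by omega⟩ : Fin N)) _ (fun _ => Iff.rfl)] at hBC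
  refine ⟨?_, ?_, ?_⟩ <;> linarith

end
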